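/- arXiv:2512.02596 — 4 statements merged into one kernel-verified Lean document; each statement's English description precedes it below -/
import Mathlib

section
/- Let u, v ∈ ℕ and let M be a u × v matrix with entries from ℝ⁺ ∪ {0} with no row equal to the zero row. If C ⊆ ℝ⁺ is a P* set near zero in ℝ⁺, then {x ∈ (ℝ⁺)^v : M·x ∈ C^u} is a P* set near zero in (ℝ⁺)^v. -/
open Set Filter

/-- The positive reals `ℝ⁺ = (0,∞)` as a type. -/
abbrev Rpos : Type := {x : ℝ // 0 < x}

/-- `A ⊆ ℝ⁺` is a *P set near zero*: for every `k ∈ ℕ` and `ε > 0` there are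
`a, d ∈ ℝ⁺` with `a + t·d ∈ A ∩ (0,ε)` for all `t ∈ {1,…,k}`. -/
def PSetNearZero1 (A : Set Rpos) : Prop :=
  ∀ k : ℕ, ∀ ε : ℝ, 0 < ε → ∃ a d : Rpos,
    ∀ t : ℕ, 1 ≤ t → t ≤ k → ∃ y ∈ A, (y : ℝ) = (a : ℝ) + (t : ℝ) * (d : ℝ) ∧ (y : ℝ) < ε

/-- `A ⊆ ℝ⁺` is a *P\* set near zero*: its complement is not a P set near zero. -/
def PStar1 (A : Set Rpos) : Prop := ¬ PSetNearZero1 Aᶜ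

/-- `A ⊆ (ℝ⁺)^v` is a *P set near zero*: for every `k ∈ ℕ` and `ε > 0` there are
`a, d ∈ (ℝ⁺)^v` with `a + t·d ∈ A ∩ (0,ε)^v` for all `t ∈ {1,…,k}`. -/
def PSetNearZeroV (v : ℕ) (A : Set (Fin v → Rpos)) : Prop :=
  ∀ k : ℕ, ∀ ε : ℝ, 0 < ε → ∃ a d : Fin v → Rpos,
    ∀ t : ℕ, 1 ≤ t → t ≤ k → ∃ y ∈ A,
      (∀ j, (y j : ℝ) = (a j : ℝ) + (t : ℝ) * (d j : ℝ)) ∧ ∀ j, (y j : ℝ) < ε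

/-- `A ⊆ (ℝ⁺)^v` is a *P\* set near zero*: its complement is not a P set near zero. -/
def PStarV (v : ℕ) (A : Set (Fin v → Rpos)) : Prop := ¬ PSetNearZeroV v Aᶜ

/-- The finitary **van der Waerden theorem**: some initial segment `{1,…,N}` contains, for every
colouring with finitely many colours, a monochromatic progression `b, b + c, …, b + k·c`. -/
theorem exists_mono_arith_progression (κ : Type) [Finite κ] (k : ℕ) :
    ∃ N : ℕ, ∀ f : ℕ → κ, ∃ b c : ℕ, 1 ≤ b ∧ 1 ≤ c ∧ b + k * c ≤ N ∧
      ∃ i, ∀ s ≤ k, f (b + s * c) = i := by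
  classical
  obtain ⟨ι, _, hι⟩ := Combinatorics.Line.exists_mono_in_high_dimension (Fin (k + 1)) κ
  refine ⟨1 + Fintype.card ι * k, fun f => ?_⟩
  obtain ⟨l, i, hl⟩ := hι fun w => f (1 + ∑ j, (w j : ℕ))
  obtain ⟨j₀, hj₀⟩ := l.proper
  have hsum : ∀ s : Fin (k + 1), 1 + ∑ j, (l s j : ℕ) =
      1 + (∑ j, ((l.idxFun j).elim 0 fun x => (x : ℕ))) +
        s * ∑ j, (if l.idxFun j = none then 1 else 0) := by
    intro s
    rw [add_assoc, Finset.mul_sum, ← Finset.sum_add_distrib]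
    congr 1
    refine Finset.sum_congr rfl fun j _ => ?_
    rw [Combinatorics.Line.apply_def]
    cases h : l.idxFun j <;> simp [h]
  refine ⟨1 + ∑ j, ((l.idxFun j).elim 0 fun x => (x : ℕ)),
    ∑ j, (if l.idxFun j = none then 1 else 0), by omega, ?_, ?_, i, fun s hs => ?_⟩
  · calc 1 = if l.idxFun j₀ = none then 1 else 0 := by simp [hj₀]
      _ ≤ _ := Finset.single_le_sum (f := fun j => if l.idxFun j = none then 1 else 0)
        (fun _ _ => Nat.zero_le _) (Finset.mem_univ j₀)
  · have h := hsum (Fin.last k)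
    rw [Fin.val_last] at h
    rw [← h]
    gcongr
    simpa using Finset.sum_le_card_nsmul Finset.univ (fun j => (l (Fin.last k) j : ℕ)) k
      fun j _ => Nat.lt_succ_iff.mp (l (Fin.last k) j).isLt
  · have h := hsum ⟨s, Nat.lt_succ_of_le hs⟩
    have := hl ⟨s, Nat.lt_succ_of_le hs⟩
    simpa only [h] using this

/-- If `M` is a `u × v` matrix with entries from `ℝ⁺ ∪ {0}` and no zero row, and `C ⊆ ℝ⁺`
is a P\* set near zero in `ℝ⁺`, then `{x ∈ (ℝ⁺)^v : M·x ∈ C^u}` is a P\* set near zero in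
`(ℝ⁺)^v`. -/
theorem pStar_preserved {u v : ℕ} (hu : 1 ≤ u) (hv : 1 ≤ v)
    (M : Fin u → Fin v → ℝ) (hMnn : ∀ i j, 0 ≤ M i j) (hrow : ∀ i, ∃ j, M i j ≠ 0)
    (C : Set ℝ) (hC : C ⊆ Set.Ioi 0) (hP : PStar1 {a : Rpos | (a : ℝ) ∈ C}) :
    PStarV v {x : Fin v → Rpos | ∀ i : Fin u, (∑ j, M i j * (x j : ℝ)) ∈ C} := by
  intro hV
  apply hP
  intro k ε hε
  obtain ⟨N, hN⟩ := exists_mono_arith_progression (Fin u) k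
  have hpos : ∀ (i : Fin u) (x : Fin v → ℝ), (∀ j, 0 < x j) → 0 < ∑ j, M i j * x j := by
    intro i x hx
    obtain ⟨j, hj⟩ := hrow i
    exact Finset.sum_pos' (fun j _ => mul_nonneg (hMnn i j) (hx j).le)
      ⟨j, Finset.mem_univ j, mul_pos ((hMnn i j).lt_of_ne' hj) (hx j)⟩
  have hSnn : 0 ≤ ∑ i, ∑ j, M i j :=
    Finset.sum_nonneg fun i _ => Finset.sum_nonneg fun j _ => hMnn i j
  set S := ∑ i, ∑ j, M i j
  obtain ⟨a, d, had⟩ := hV N (ε / (1 + S)) (by positivity)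
  have hcol : ∀ t : ℕ, ∃ i : Fin u, 1 ≤ t → t ≤ N →
      (∑ j, M i j * ((a j : ℝ) + t * d j)) ∉ C ∧
        ∑ j, M i j * ((a j : ℝ) + t * d j) < ε := by
    intro t
    by_cases ht : 1 ≤ t ∧ t ≤ N
    · obtain ⟨y, hyC, hy, hyε⟩ := had t ht.1 ht.2
      simp only [mem_compl_iff, mem_ofPred_eq, not_forall] at hyC
      obtain ⟨i, hi⟩ := hyC
      simp only [hy] at hi hyε
      refine ⟨i, fun _ _ => ⟨hi, ?_⟩⟩
      calc ∑ j, M i j * ((a j : ℝ) + t * d j)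
          ≤ ∑ j, M i j * (ε / (1 + S)) :=
            Finset.sum_le_sum fun j _ => mul_le_mul_of_nonneg_left (hyε j).le (hMnn i j)
        _ = (∑ j, M i j) * (ε / (1 + S)) := (Finset.sum_mul ..).symm
        _ ≤ S * (ε / (1 + S)) := by
            gcongr
            exact Finset.single_le_sum (f := fun i => ∑ j, M i j)
              (fun i _ => Finset.sum_nonneg fun j _ => hMnn i j) (Finset.mem_univ i)
        _ < (1 + S) * (ε / (1 + S)) := by
            gcongr
            linarith
        _ = ε := by field_simp
    · exact ⟨⟨0, hu⟩, fun h₁ h₂ => absurd ⟨h₁, h₂⟩ ht⟩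
  choose f hf using hcol
  obtain ⟨b, c, hb, hc, hbc, i, hi⟩ := hN f
  have hc' : (0 : ℝ) < c := by exact_mod_cast hc
  have hA := hpos i (fun j => (a j : ℝ) + b * d j) fun j =>
    add_pos_of_pos_of_nonneg (a j).2 (mul_nonneg b.cast_nonneg (d j).2.le)
  have hD := hpos i (fun j => (c : ℝ) * d j) fun j => mul_pos hc' (d j).2
  refine ⟨⟨_, hA⟩, ⟨_, hD⟩, fun s _ hs => ?_⟩
  obtain ⟨hnot, hlt⟩ := hf (b + s * c) (by omega)
    ((Nat.add_le_add_left (Nat.mul_le_mul_right c hs) b).trans hbc)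
  have heq : ∑ j, M i j * ((a j : ℝ) + (b + s * c : ℕ) * d j) =
      ∑ j, M i j * ((a j : ℝ) + b * d j) + s * ∑ j, M i j * ((c : ℝ) * d j) := by
    rw [Finset.mul_sum, ← Finset.sum_add_distrib]
    refine Finset.sum_congr rfl fun j _ => ?_
    push_cast
    ring
  rw [hi s hs, heq] at hnot hlt
  exact ⟨⟨_, add_pos_of_pos_of_nonneg hA (mul_nonneg s.cast_nonneg hD.le)⟩, hnot, rfl, hlt⟩
end

section
/- Let u, v ∈ ℕ and let M be a u × v matrix with entries from ℝ⁺ ∪ {0} which is image partition regular over ℝ⁺. If C ⊆ ℝ⁺ is a central* set near zero in ℝ⁺, then {x ∈ (ℝ⁺)^v : M·x ∈ C^u} is a central* set near zero in (ℝ⁺)^v. -/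
open Set Filter

attribute [local instance] Ultrafilter.add Ultrafilter.addSemigroup

/-- `0⁺(ℝ⁺)`: ultrafilters on `ℝ⁺` containing `(0,ε)` for every `ε > 0`. -/
def zeroPlus1 : Set (Ultrafilter Rpos) :=
  {p | ∀ ε : ℝ, 0 < ε → {x : Rpos | (x : ℝ) < ε} ∈ p}

/-- `0⁺((ℝ⁺)^v)`: ultrafilters on `(ℝ⁺)^v` containing `(0,ε)^v` for every `ε > 0`. -/
def zeroPlusV (v : ℕ) : Set (Ultrafilter (Fin v → Rpos)) :=
  {p | ∀ ε : ℝ, 0 < ε → {x : Fin v → Rpos | ∀ j, (x j : ℝ) < ε} ∈ p}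

/-- `I` is a (nonempty, two-sided) ideal of the subsemigroup `T` of the ultrafilter
semigroup `βγ`. -/
def IsIdealIn {γ : Type} [AddSemigroup γ] (T I : Set (Ultrafilter γ)) : Prop :=
  I.Nonempty ∧ I ⊆ T ∧ (∀ p ∈ T, ∀ q ∈ I, p + q ∈ I) ∧ ∀ p ∈ T, ∀ q ∈ I, q + p ∈ I

/-- `p` belongs to the smallest two-sided ideal `K(T)` of `T`: equivalently, `p ∈ T` and
`p` belongs to every nonempty two-sided ideal of `T`. -/
def memK {γ : Type} [AddSemigroup γ] (T : Set (Ultrafilter γ)) (p : Ultrafilter γ) : Prop :=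
  p ∈ T ∧ ∀ I : Set (Ultrafilter γ), IsIdealIn T I → p ∈ I

/-- `M` is image partition regular over `ℝ⁺` (IPR/ℝ⁺): whenever `ℝ⁺` is partitioned into
finitely many cells, there are a cell `i` and `x ∈ (ℝ⁺)^v` such that every entry of `M·x`
lies in `ℝ⁺` and in the cell `i`. -/
def IPR {u v : ℕ} (M : Fin u → Fin v → ℝ) : Prop :=
  ∀ (r : ℕ) (c : Rpos → Fin r), ∃ (i : Fin r) (x : Fin v → Rpos),
    ∀ k : Fin u, ∃ h : 0 < ∑ j, M k j * (x j : ℝ), c ⟨∑ j, M k j * (x j : ℝ), h⟩ = i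

/-- `A ⊆ ℝ⁺` is a *central\* set near zero*: `A` belongs to every idempotent in
`K(0⁺(ℝ⁺))`. -/
def CentralStar1 (A : Set Rpos) : Prop :=
  ∀ p : Ultrafilter Rpos, p + p = p → memK zeroPlus1 p → A ∈ p

/-- `A ⊆ (ℝ⁺)^v` is a *central\* set near zero*: `A` belongs to every idempotent in
`K(0⁺((ℝ⁺)^v))`. -/
def CentralStarV (v : ℕ) (A : Set (Fin v → Rpos)) : Prop :=
  ∀ p : Ultrafilter (Fin v → Rpos), p + p = p → memK (zeroPlusV v) p → A ∈ p

/-- Pushing ultrafilters forward along an additive map is additive. -/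
theorem Ultrafilter.map_add_of_additive {γ δ : Type} [AddSemigroup γ] [AddSemigroup δ]
    (f : γ → δ) (hf : ∀ x y, f (x + y) = f x + f y) (p q : Ultrafilter γ) :
    (p + q).map f = p.map f + q.map f := by
  apply Ultrafilter.coe_injective
  ext A
  change (∀ᶠ m in (p + q : Ultrafilter γ), f m ∈ A) ↔
    ∀ᶠ m in (p.map f + q.map f : Ultrafilter δ), m ∈ A
  rw [Ultrafilter.eventually_add, Ultrafilter.eventually_add]
  simp only [Ultrafilter.coe_map, Filter.eventually_map, hf]

/-- If an additive map carries `T` onto `T'`, it carries `K(T)` into `K(T')`. -/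
theorem memK_map {γ δ : Type} [AddSemigroup γ] [AddSemigroup δ]
    (f : γ → δ) (hf : ∀ x y, f (x + y) = f x + f y)
    {T : Set (Ultrafilter γ)} {T' : Set (Ultrafilter δ)}
    (hadd : ∀ p ∈ T, ∀ q ∈ T, p + q ∈ T)
    (hmaps : ∀ p ∈ T, p.map f ∈ T') (hsurj : ∀ q ∈ T', ∃ p ∈ T, p.map f = q)
    {p : Ultrafilter γ} (hp : memK T p) : memK T' (p.map f) := by
  refine ⟨hmaps p hp.1, fun I hI => ?_⟩
  obtain ⟨⟨q, hq⟩, hsub, hleft, hright⟩ := hI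
  have key : IsIdealIn T {r | r ∈ T ∧ r.map f ∈ I} := by
    refine ⟨?_, fun r hr => hr.1, ?_, ?_⟩
    · obtain ⟨r, hr, rfl⟩ := hsurj q (hsub hq)
      exact ⟨r, hr, hq⟩
    · rintro r hr s ⟨hs, hsI⟩
      refine ⟨hadd r hr s hs, ?_⟩
      rw [Ultrafilter.map_add_of_additive f hf]
      exact hleft _ (hmaps r hr) _ hsI
    · rintro r hr s ⟨hs, hsI⟩
      refine ⟨hadd s hs r hr, ?_⟩
      rw [Ultrafilter.map_add_of_additive f hf]
      exact hright _ (hmaps r hr) _ hsI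
  exact (hp.2 _ key).2

/-- `0⁺((ℝ⁺)^v)` is closed under addition. -/
theorem add_mem_zeroPlusV {v : ℕ} (p : Ultrafilter (Fin v → Rpos)) (hp : p ∈ zeroPlusV v)
    (q : Ultrafilter (Fin v → Rpos)) (hq : q ∈ zeroPlusV v) : p + q ∈ zeroPlusV v := by
  intro ε hε
  change ∀ᶠ x in ((p + q : Ultrafilter (Fin v → Rpos)) : Filter (Fin v → Rpos)), ∀ j, (x j : ℝ) < ε
  rw [Ultrafilter.eventually_add]
  filter_upwards [hp (ε / 2) (half_pos hε)] with x hx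
  filter_upwards [hq (ε / 2) (half_pos hε)] with y hy j
  have h : ((x + y) j : ℝ) = x j + y j := rfl
  linarith [hx j, hy j]

/-- The map `x ↦ ∑ j, a j * x j` from `(ℝ⁺)^v` to `ℝ⁺`, for a nonzero vector `a` of
nonnegative reals. -/
noncomputable def posDot {v : ℕ} (a : Fin v → ℝ) (ha : ∀ j, 0 ≤ a j) (hs : 0 < ∑ j, a j)
    (x : Fin v → Rpos) : Rpos :=
  ⟨∑ j, a j * (x j : ℝ), by
    obtain ⟨j, hj, hlt⟩ := Finset.exists_lt_of_sum_lt (Finset.sum_const_zero.trans_lt hs)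
    exact Finset.sum_pos' (fun i _ => mul_nonneg (ha i) (x i).2.le)
      ⟨j, hj, mul_pos hlt (x j).2⟩⟩

theorem posDot_add {v : ℕ} (a : Fin v → ℝ) (ha : ∀ j, 0 ≤ a j) (hs : 0 < ∑ j, a j)
    (x y : Fin v → Rpos) : posDot a ha hs (x + y) = posDot a ha hs x + posDot a ha hs y := by
  apply Subtype.ext
  change ∑ j, a j * ((x j : ℝ) + y j) = ∑ j, a j * (x j : ℝ) + ∑ j, a j * (y j : ℝ)
  simp only [mul_add, Finset.sum_add_distrib]

theorem map_posDot_mem {v : ℕ} (a : Fin v → ℝ) (ha : ∀ j, 0 ≤ a j) (hs : 0 < ∑ j, a j)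
    (p : Ultrafilter (Fin v → Rpos)) (hp : p ∈ zeroPlusV v) :
    p.map (posDot a ha hs) ∈ zeroPlus1 := by
  intro ε hε
  change ∀ᶠ x in (p : Filter (Fin v → Rpos)), ∑ j, a j * (x j : ℝ) < ε
  filter_upwards [hp (ε / 2 / ∑ j, a j) (by positivity)] with x hx
  calc ∑ j, a j * (x j : ℝ) ≤ ∑ j, a j * (ε / 2 / ∑ j, a j) :=
        Finset.sum_le_sum fun j _ => mul_le_mul_of_nonneg_left (hx j).le (ha j)
    _ = ε / 2 := by rw [← Finset.sum_mul]; field_simp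
    _ < ε := half_lt_self hε

theorem exists_map_posDot_eq {v : ℕ} (a : Fin v → ℝ) (ha : ∀ j, 0 ≤ a j)
    (hs : 0 < ∑ j, a j) (q : Ultrafilter Rpos) (hq : q ∈ zeroPlus1) :
    ∃ p ∈ zeroPlusV v, p.map (posDot a ha hs) = q := by
  let diag : Rpos → Fin v → Rpos := fun y _ => ⟨y / ∑ j, a j, div_pos y.2 hs⟩
  refine ⟨q.map diag, fun ε hε => ?_, ?_⟩
  · change ∀ᶠ y : Rpos in (q : Filter Rpos), ∀ _ : Fin v, (y : ℝ) / ∑ j, a j < ε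
    filter_upwards [hq (ε * ∑ j, a j) (by positivity)] with y hy _
    exact (div_lt_iff₀ hs).2 hy
  · have hid : posDot a ha hs ∘ diag = id := by
      funext y
      apply Subtype.ext
      change ∑ j, a j * ((y : ℝ) / ∑ j, a j) = y
      rw [← Finset.sum_mul]
      field_simp
    rw [Ultrafilter.map_map, hid, Ultrafilter.map_id]

/-- If `M` is a `u × v` matrix with entries from `ℝ⁺ ∪ {0}` which is IPR/ℝ⁺ and `C ⊆ ℝ⁺`
is a central\* set near zero in `ℝ⁺`, then `{x ∈ (ℝ⁺)^v : M·x ∈ C^u}` is a central\* set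
near zero in `(ℝ⁺)^v`. -/
theorem centralStar_preserved {u v : ℕ} (hu : 1 ≤ u) (hv : 1 ≤ v)
    (M : Fin u → Fin v → ℝ) (hMnn : ∀ i j, 0 ≤ M i j) (hIPR : IPR M)
    (C : Set ℝ) (hC : C ⊆ Set.Ioi 0) (hCen : CentralStar1 {a : Rpos | (a : ℝ) ∈ C}) :
    CentralStarV v {x : Fin v → Rpos | ∀ i : Fin u, (∑ j, M i j * (x j : ℝ)) ∈ C} := by
  intro p hpp hpK
  have hs : ∀ i, 0 < ∑ j, M i j := by
    intro i
    obtain ⟨_, x, hx⟩ := hIPR 1 (fun _ => 0)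
    obtain ⟨hpos, _⟩ := hx i
    obtain ⟨j, hj, hlt⟩ := Finset.exists_lt_of_sum_lt (Finset.sum_const_zero.trans_lt hpos)
    exact Finset.sum_pos' (fun k _ => hMnn i k) ⟨j, hj, pos_of_mul_pos_left hlt (x j).2.le⟩
  change ∀ᶠ x in (p : Filter (Fin v → Rpos)), ∀ i, ∑ j, M i j * (x j : ℝ) ∈ C
  rw [Filter.eventually_all]
  intro i
  refine hCen (p.map (posDot (M i) (hMnn i) (hs i))) ?_ ?_
  · rw [← Ultrafilter.map_add_of_additive _ (posDot_add _ _ _), hpp]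
  · exact memK_map _ (posDot_add _ _ _) add_mem_zeroPlusV (map_posDot_mem _ _ _)
      (exists_map_posDot_eq _ _ _) hpK
end

section
/- Let u, v ∈ ℕ and let M be a u × v matrix with entries from ℝ⁺ ∪ {0} with no row equal to the zero row. If q ∈ J₀((ℝ⁺)^v) and φ̃(q) = (p₁,…,p_u), then for each i ∈ {1,…,u}, pᵢ ∈ J₀(ℝ⁺). -/
open Set Filter

attribute [local instance] Ultrafilter.add Ultrafilter.addSemigroup

/-- The `i`-th component of the continuous extension `φ̃` of `φ(x) = M·x` applied to `q`:
the pushforward (image) ultrafilter of `q` under `x ↦ (M·x)ᵢ` (values read in `ℝ`). -/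
def phiMap {u v : ℕ} (M : Fin u → Fin v → ℝ) (q : Ultrafilter (Fin v → Rpos)) :
    Fin u → Ultrafilter ℝ :=
  fun i => Ultrafilter.map (fun x : Fin v → Rpos => ∑ j, M i j * (x j : ℝ)) q

/-- `A ⊆ (ℝ⁺)^v` is a *J set near zero*: for every finite nonempty family `F` of
sequences in `(ℝ⁺)^v` converging to the zero vector and every `δ > 0`, there are
`a ∈ (0,δ)^v` and a finite nonempty `H ⊆ ℕ` with `a + ∑_{t∈H} f(t) ∈ A` for all
`f ∈ F`. -/
def JSetNearZeroV (v : ℕ) (A : Set (Fin v → Rpos)) : Prop :=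
  ∀ F : Set (ℕ → Fin v → Rpos), F.Finite → F.Nonempty →
    (∀ f ∈ F, ∀ ε : ℝ, 0 < ε → ∃ N : ℕ, ∀ n ≥ N, ∀ j, (f n j : ℝ) < ε) →
    ∀ δ : ℝ, 0 < δ →
      ∃ a : Fin v → Rpos, (∀ j, (a j : ℝ) < δ) ∧ ∃ H : Finset ℕ, H.Nonempty ∧
        ∀ f ∈ F, ∃ y ∈ A, ∀ j, (y j : ℝ) = (a j : ℝ) + ∑ t ∈ H, (f t j : ℝ)

/-- `J₀((ℝ⁺)^v)`: the members of `0⁺((ℝ⁺)^v)` all of whose members are J sets near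
zero. -/
def J0V (v : ℕ) : Set (Ultrafilter (Fin v → Rpos)) :=
  {p | p ∈ zeroPlusV v ∧ ∀ A, A ∈ p → JSetNearZeroV v A}

/-- `A` (a set of reals, thought of as a subset of `ℝ⁺`) is a *J set near zero in `ℝ⁺`*. -/
def JSetNearZeroR (A : Set ℝ) : Prop :=
  ∀ F : Set (ℕ → Rpos), F.Finite → F.Nonempty →
    (∀ f ∈ F, ∀ ε : ℝ, 0 < ε → ∃ N : ℕ, ∀ n ≥ N, (f n : ℝ) < ε) →
    ∀ δ : ℝ, 0 < δ →
      ∃ a : Rpos, (a : ℝ) < δ ∧ ∃ H : Finset ℕ, H.Nonempty ∧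
        ∀ f ∈ F, ((a : ℝ) + ∑ t ∈ H, (f t : ℝ)) ∈ A

/-- A nonnegative, nonzero linear form is positive on `(ℝ⁺)^v`. -/
lemma linearForm_pos {v : ℕ} {c : Fin v → ℝ} (hc : ∀ j, 0 ≤ c j) (hne : ∃ j, c j ≠ 0)
    (x : Fin v → Rpos) : 0 < ∑ j, c j * (x j : ℝ) := by
  obtain ⟨k, hk⟩ := hne
  exact Finset.sum_pos' (fun j _ => mul_nonneg (hc j) (x j).2.le)
    ⟨k, Finset.mem_univ k, mul_pos ((hc k).lt_of_ne' hk) (x k).2⟩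

lemma sum_coeff_pos {v : ℕ} {c : Fin v → ℝ} (hc : ∀ j, 0 ≤ c j) (hne : ∃ j, c j ≠ 0) :
    0 < ∑ j, c j := by
  simpa using linearForm_pos hc hne (fun _ => ⟨1, one_pos⟩)

/-- A nonnegative, nonzero linear form is less than `ε` on the cube of side `ε / ∑ j, c j`. -/
lemma linearForm_lt {v : ℕ} {c : Fin v → ℝ} (hc : ∀ j, 0 ≤ c j) (hne : ∃ j, c j ≠ 0)
    {ε : ℝ} {x : Fin v → Rpos} (hx : ∀ j, (x j : ℝ) < ε / ∑ j, c j) :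
    ∑ j, c j * (x j : ℝ) < ε := by
  have hs := sum_coeff_pos hc hne
  obtain ⟨k, hk⟩ := hne
  calc ∑ j, c j * (x j : ℝ) < ∑ j, c j * (ε / ∑ j, c j) :=
        Finset.sum_lt_sum (fun j _ => mul_le_mul_of_nonneg_left (hx j).le (hc j))
          ⟨k, Finset.mem_univ k, mul_lt_mul_of_pos_left (hx k) ((hc k).lt_of_ne' hk)⟩
    _ = ε := by rw [← Finset.sum_mul, mul_div_cancel₀ _ hs.ne']

/-- If the preimage of `A` under a nonnegative, nonzero linear form is a J set near zero,
then so is `A`. -/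
lemma JSetNearZeroV.of_preimage_linearForm {v : ℕ} {c : Fin v → ℝ} (hc : ∀ j, 0 ≤ c j)
    (hne : ∃ j, c j ≠ 0) {A : Set ℝ}
    (hA : JSetNearZeroV v ((fun x : Fin v → Rpos => ∑ j, c j * (x j : ℝ)) ⁻¹' A)) :
    JSetNearZeroR A := by
  intro F hfin hF hlim δ hδ
  have hs := sum_coeff_pos hc hne
  let diag : (ℕ → Rpos) → ℕ → Fin v → Rpos :=
    fun f t _ => ⟨(f t : ℝ) / ∑ j, c j, div_pos (f t).2 hs⟩
  have hlim' : ∀ g ∈ diag '' F, ∀ ε : ℝ, 0 < ε →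
      ∃ N : ℕ, ∀ n ≥ N, ∀ j, (g n j : ℝ) < ε := by
    rintro _ ⟨f, hf, rfl⟩ ε hε
    obtain ⟨N, hN⟩ := hlim f hf (ε * ∑ j, c j) (mul_pos hε hs)
    exact ⟨N, fun n hn _ => (div_lt_iff₀ hs).2 (hN n hn)⟩
  obtain ⟨a, ha, H, hH, hmem⟩ := hA (diag '' F) (hfin.image diag) (hF.image diag) hlim'
    (δ / ∑ j, c j) (div_pos hδ hs)
  refine ⟨⟨∑ j, c j * (a j : ℝ), linearForm_pos hc hne a⟩, linearForm_lt hc hne ha,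
    H, hH, fun f hf => ?_⟩
  obtain ⟨y, hy, hya⟩ := hmem (diag f) (mem_image_of_mem diag hf)
  have hsum : ∑ j, c j * (y j : ℝ) = ∑ j, c j * (a j : ℝ) + ∑ t ∈ H, (f t : ℝ) := by
    simp only [hya, diag, mul_add, Finset.sum_add_distrib, ← Finset.sum_div, ← Finset.sum_mul]
    rw [mul_div_cancel₀ _ hs.ne']
  exact hsum ▸ hy

/-- If `M` is a `u × v` matrix with entries from `ℝ⁺ ∪ {0}` and no zero row, and
`q ∈ J₀((ℝ⁺)^v)` with `φ̃(q) = (p₁,…,p_u)`, then each `pᵢ ∈ J₀(ℝ⁺)`: `pᵢ` lies in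
`0⁺(ℝ⁺)` and every member of `pᵢ` is a J set near zero. -/
theorem phiMap_mem_J0 {u v : ℕ} (hu : 1 ≤ u) (hv : 1 ≤ v)
    (M : Fin u → Fin v → ℝ) (hMnn : ∀ i j, 0 ≤ M i j) (hrow : ∀ i, ∃ j, M i j ≠ 0)
    (q : Ultrafilter (Fin v → Rpos)) (hq : q ∈ J0V v) :
    ∀ i : Fin u, (∀ ε : ℝ, 0 < ε → Set.Ioo (0 : ℝ) ε ∈ phiMap M q i) ∧
      ∀ A : Set ℝ, A ∈ phiMap M q i → JSetNearZeroR A := by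
  intro i
  refine ⟨fun ε hε => ?_, fun A hA =>
    JSetNearZeroV.of_preimage_linearForm (hMnn i) (hrow i) (hq.2 _ (Ultrafilter.mem_map.1 hA))⟩
  refine Ultrafilter.mem_map.2 (mem_of_superset
    (hq.1 _ (div_pos hε (sum_coeff_pos (hMnn i) (hrow i)))) fun x hx => ?_)
  exact ⟨linearForm_pos (hMnn i) (hrow i) x, linearForm_lt (hMnn i) (hrow i) hx⟩
end

section
/- Let u, v ∈ ℕ and let M be a u × v matrix with entries from ℝ⁺ ∪ {0} with no row equal to the zero row. If C ⊆ ℝ⁺ is an IP* set near zero in ℝ⁺, then {x ∈ (ℝ⁺)^v : M·x ∈ C^u} is an IP* set near zero in (ℝ⁺)^v. -/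
open Set Filter

attribute [local instance] Ultrafilter.add Ultrafilter.addSemigroup

/-- `A ⊆ ℝ⁺` is an *IP\* set near zero*: `A` belongs to every idempotent in `0⁺(ℝ⁺)`. -/
def IPStar1 (A : Set Rpos) : Prop :=
  ∀ p : Ultrafilter Rpos, p ∈ zeroPlus1 → p + p = p → A ∈ p

/-- `A ⊆ (ℝ⁺)^v` is an *IP\* set near zero*: `A` belongs to every idempotent in
`0⁺((ℝ⁺)^v)`. -/
def IPStarV (v : ℕ) (A : Set (Fin v → Rpos)) : Prop :=
  ∀ p : Ultrafilter (Fin v → Rpos), p ∈ zeroPlusV v → p + p = p → A ∈ p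

/-- The extension of an additive map to ultrafilters is additive. -/
theorem Ultrafilter.map_add_of_addHom {S T : Type*} [Add S] [Add T] (f : S →ₙ+ T)
    (p q : Ultrafilter S) : (p + q).map f = p.map f + q.map f := by
  refine Ultrafilter.ext fun A => ?_
  change (∀ᶠ x in ((p + q : Ultrafilter S) : Filter S), f x ∈ A) ↔
    ∀ᶠ y in ((p.map f + q.map f : Ultrafilter T) : Filter T), y ∈ A
  simp only [Ultrafilter.eventually_add, Ultrafilter.coe_map, Filter.eventually_map, map_add]

theorem sum_mul_rpos_pos {v : ℕ} {r : Fin v → ℝ} (hr : ∀ j, 0 ≤ r j) (hne : ∃ j, r j ≠ 0)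
    (x : Fin v → Rpos) : 0 < ∑ j, r j * (x j : ℝ) := by
  obtain ⟨j, hj⟩ := hne
  exact Finset.sum_pos' (fun k _ => mul_nonneg (hr k) (x k).2.le)
    ⟨j, Finset.mem_univ j, mul_pos ((hr j).lt_of_ne' hj) (x j).2⟩

/-- The additive map `(ℝ⁺)^v → ℝ⁺` given by a nonzero row with nonnegative entries. -/
def rowHom {v : ℕ} (r : Fin v → ℝ) (hr : ∀ j, 0 ≤ r j) (hne : ∃ j, r j ≠ 0) :
    (Fin v → Rpos) →ₙ+ Rpos where
  toFun x := ⟨∑ j, r j * (x j : ℝ), sum_mul_rpos_pos hr hne x⟩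
  map_add' x y := Subtype.ext <| by
    simp [mul_add, Finset.sum_add_distrib]

theorem map_rowHom_mem_zeroPlus1 {v : ℕ} {r : Fin v → ℝ} (hr : ∀ j, 0 ≤ r j)
    (hne : ∃ j, r j ≠ 0) {p : Ultrafilter (Fin v → Rpos)} (hp : p ∈ zeroPlusV v) :
    p.map (rowHom r hr hne) ∈ zeroPlus1 := by
  intro ε hε
  have hS : 0 ≤ ∑ j, r j := Finset.sum_nonneg fun j _ => hr j
  refine Ultrafilter.mem_map.2 <|
    mem_of_superset (hp (ε / (∑ j, r j + 1)) (by positivity)) fun x hx => ?_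
  change ∑ j, r j * (x j : ℝ) < ε
  calc ∑ j, r j * (x j : ℝ) ≤ ∑ j, r j * (ε / (∑ j, r j + 1)) :=
        Finset.sum_le_sum fun j _ => mul_le_mul_of_nonneg_left (hx j).le (hr j)
    _ = (∑ j, r j) * ε / (∑ j, r j + 1) := by rw [← Finset.sum_mul, mul_div_assoc]
    _ < ε := by
        rw [div_lt_iff₀ (by positivity)]
        linarith

/-- If `M` is a `u × v` matrix with entries from `ℝ⁺ ∪ {0}` and no zero row, and `C ⊆ ℝ⁺`
is an IP\* set near zero in `ℝ⁺`, then `{x ∈ (ℝ⁺)^v : M·x ∈ C^u}` is an IP\* set near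
zero in `(ℝ⁺)^v`. -/
theorem ipStar_preserved {u v : ℕ} (hu : 1 ≤ u) (hv : 1 ≤ v)
    (M : Fin u → Fin v → ℝ) (hMnn : ∀ i j, 0 ≤ M i j) (hrow : ∀ i, ∃ j, M i j ≠ 0)
    (C : Set ℝ) (hC : C ⊆ Set.Ioi 0) (hIP : IPStar1 {a : Rpos | (a : ℝ) ∈ C}) :
    IPStarV v {x : Fin v → Rpos | ∀ i : Fin u, (∑ j, M i j * (x j : ℝ)) ∈ C} := by
  intro p hp hpp
  have hrows : ∀ i, {x : Fin v → Rpos | (∑ j, M i j * (x j : ℝ)) ∈ C} ∈ p := fun i =>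
    hIP (p.map (rowHom (M i) (hMnn i) (hrow i)))
      (map_rowHom_mem_zeroPlus1 (hMnn i) (hrow i) hp)
      (by rw [← Ultrafilter.map_add_of_addHom, hpp])
  exact Filter.eventually_all.2 hrows
end
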